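/- arXiv:0902.1935 — 2 statements merged into one kernel-verified Lean document; each statement's English description precedes it below -/
import Mathlib

section
/- Let A, B, C, D ∈ Mat(L,ℂ) be the blocks of a matrix T = [[A,B],[C,D]] ∈ Mat(2L,ℂ) satisfying T*·J·T = J (equivalently also T·J·T* = J, so that A·B* = B·A*, C·D* = D·C* and A·D* − B·C* = 1). Let M₊, M₋ ∈ Mat(L,ℂ) be such that the four matrices D* − B*·M₊, D* + B*·M₋, D − M₊·B and D + M₋·B are invertible, and define M₊⁺ := (−C* + A*·M₊)·(D* − B*·M₊)⁻¹ and M₋⁺ := (C* + A*·M₋)·(D* + B*·M₋)⁻¹. Then M₊⁺ + M₋⁺ = (D − M₊·B)⁻¹·(M₊ + M₋)·(D* + B*·M₋)⁻¹ = (D + M₋·B)⁻¹·(M₊ + M₋)·(D* − B*·M₊)⁻¹. -/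
open Matrix

noncomputable section

/-- The `2L × 2L` matrix `J = [[0, -1],[1, 0]]`, with index type `Fin L ⊕ Fin L`. -/
def Jmat (L : ℕ) : Matrix (Fin L ⊕ Fin L) (Fin L ⊕ Fin L) ℂ :=
  Matrix.fromBlocks 0 (-1) 1 0

theorem Jmat_mul_self (L : ℕ) : Jmat L * Jmat L = -1 :=
  Matrix.J_squared (Fin L) ℂ

/-- The relation `T* J T = J` is inherited by the conjugate transpose of `T`. -/
theorem mul_Jmat_mul_conjTranspose {L : ℕ} {T : Matrix (Fin L ⊕ Fin L) (Fin L ⊕ Fin L) ℂ}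
    (hT : Tᴴ * Jmat L * T = Jmat L) : T * Jmat L * Tᴴ = Jmat L := by
  have hleft : -(Jmat L * Tᴴ * Jmat L) * T = 1 := by
    rw [neg_mul, mul_assoc, mul_assoc, ← mul_assoc Tᴴ, hT, Jmat_mul_self, neg_neg]
  have hright : T * Jmat L * Tᴴ * Jmat L = -1 := by
    rw [← neg_eq_iff_eq_neg, ← mul_eq_one_comm.mp hleft]
    noncomm_ring
  have h := congrArg (· * Jmat L) hright
  simpa [mul_assoc, Jmat_mul_self] using h

/-- The block form of `T J T* = J`. -/
theorem block_relations {L : ℕ} {A B C D : Matrix (Fin L) (Fin L) ℂ}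
    (hT : (Matrix.fromBlocks A B C D)ᴴ * Jmat L * Matrix.fromBlocks A B C D = Jmat L) :
    B * Aᴴ = A * Bᴴ ∧ D * Cᴴ = C * Dᴴ ∧ A * Dᴴ = 1 + B * Cᴴ ∧ D * Aᴴ = 1 + C * Bᴴ := by
  have h := mul_Jmat_mul_conjTranspose hT
  simp only [Jmat, fromBlocks_conjTranspose, fromBlocks_multiply, fromBlocks_inj, mul_zero,
    mul_one, mul_neg, zero_add, add_zero, neg_mul] at h
  obtain ⟨h11, h12, h21, h22⟩ := h
  refine ⟨add_neg_eq_zero.mp h11, add_neg_eq_zero.mp h22, ?_, eq_add_of_add_neg_eq h21⟩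
  rw [← neg_eq_iff_eq_neg.mpr h12]
  abel

/-- The sum of the Möbius transforms, factored with the `M₊` denominator on the left. -/
theorem moebius_sum_eq_left {L : ℕ} {A B C D : Matrix (Fin L) (Fin L) ℂ}
    (hT : (Matrix.fromBlocks A B C D)ᴴ * Jmat L * Matrix.fromBlocks A B C D = Jmat L)
    {Mp Mm : Matrix (Fin L) (Fin L) ℂ}
    (h1 : IsUnit (Dᴴ - Bᴴ * Mp)) (h2 : IsUnit (Dᴴ + Bᴴ * Mm)) (h3 : IsUnit (D - Mp * B)) :
    (-Cᴴ + Aᴴ * Mp) * (Dᴴ - Bᴴ * Mp)⁻¹ + (Cᴴ + Aᴴ * Mm) * (Dᴴ + Bᴴ * Mm)⁻¹ =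
      (D - Mp * B)⁻¹ * (Mp + Mm) * (Dᴴ + Bᴴ * Mm)⁻¹ := by
  obtain ⟨hBA, hDC, hAD, hDA⟩ := block_relations hT
  rw [isUnit_iff_isUnit_det] at h1 h2 h3
  have hswap : (D - Mp * B) * (-Cᴴ + Aᴴ * Mp) = (-C + Mp * A) * (Dᴴ - Bᴴ * Mp) := by
    calc _ = -(D * Cᴴ) + D * Aᴴ * Mp + Mp * (B * Cᴴ) - Mp * (B * Aᴴ) * Mp := by noncomm_ring
      _ = -(C * Dᴴ) + C * Bᴴ * Mp + Mp * (1 + B * Cᴴ) - Mp * (A * Bᴴ) * Mp := by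
        rw [hBA, hDC, hDA]; noncomm_ring
      _ = _ := by rw [← hAD]; noncomm_ring
  have hsum : (-C + Mp * A) * (Dᴴ + Bᴴ * Mm) + (D - Mp * B) * (Cᴴ + Aᴴ * Mm) = Mp + Mm := by
    calc _ = -(C * Dᴴ) + D * Cᴴ + (D * Aᴴ - C * Bᴴ) * Mm + Mp * (A * Dᴴ - B * Cᴴ)
          + Mp * (A * Bᴴ - B * Aᴴ) * Mm := by noncomm_ring
      _ = _ := by rw [hBA, hDC, hAD, hDA]; noncomm_ring
  have hplus : (-Cᴴ + Aᴴ * Mp) * (Dᴴ - Bᴴ * Mp)⁻¹ = (D - Mp * B)⁻¹ * (-C + Mp * A) := by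
    rw [← nonsing_inv_mul_cancel_left _ (-Cᴴ + Aᴴ * Mp) h3, hswap, mul_assoc,
      mul_nonsing_inv_cancel_right _ _ h1]
  rw [hplus, ← hsum, mul_add (D - Mp * B)⁻¹ (_ * _), nonsing_inv_mul_cancel_left _ _ h3,
    ← mul_assoc, add_mul (_ * _), mul_nonsing_inv_cancel_right _ _ h2]

/-- Möbius-transformation identity for the sum of Weyl–Titchmarsh matrices
at a jump (Corollary (iii) of the paper).  Here `Mp` plays the role of `M₊` and `Mm`
that of `M₋`, and `Mp⁺ = (−C* + A*·Mp)·(D* − B*·Mp)⁻¹`, `Mm⁺ = (C* + A*·Mm)·(D* + B*·Mm)⁻¹`. -/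
theorem moebius_sum_identity (L : ℕ) (hL : 0 < L)
    (A B C D : Matrix (Fin L) (Fin L) ℂ)
    (hT : (Matrix.fromBlocks A B C D)ᴴ * Jmat L * Matrix.fromBlocks A B C D = Jmat L)
    (Mp Mm : Matrix (Fin L) (Fin L) ℂ)
    (h1 : IsUnit (Dᴴ - Bᴴ * Mp)) (h2 : IsUnit (Dᴴ + Bᴴ * Mm))
    (h3 : IsUnit (D - Mp * B)) (h4 : IsUnit (D + Mm * B)) :
    (-Cᴴ + Aᴴ * Mp) * (Dᴴ - Bᴴ * Mp)⁻¹ + (Cᴴ + Aᴴ * Mm) * (Dᴴ + Bᴴ * Mm)⁻¹ =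
      (D - Mp * B)⁻¹ * (Mp + Mm) * (Dᴴ + Bᴴ * Mm)⁻¹ ∧
    (-Cᴴ + Aᴴ * Mp) * (Dᴴ - Bᴴ * Mp)⁻¹ + (Cᴴ + Aᴴ * Mm) * (Dᴴ + Bᴴ * Mm)⁻¹ =
      (D + Mm * B)⁻¹ * (Mp + Mm) * (Dᴴ - Bᴴ * Mp)⁻¹ := by
  refine ⟨moebius_sum_eq_left hT h1 h2 h3, ?_⟩
  have h := moebius_sum_eq_left hT (Mp := -Mm) (Mm := -Mp)
    (by simpa using h2) (by simpa [← sub_eq_add_neg] using h1) (by simpa using h4)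
  simp only [mul_neg, neg_mul, sub_neg_eq_add, ← sub_eq_add_neg] at h
  rw [← neg_inj]
  convert h using 1 <;> noncomm_ring
end
end

section
/- (Diagonalization of positive elements of 𝔾.) Let M ∈ 𝔾 be hermitian positive definite. Then there exist a unitary matrix U ∈ 𝔾 with det(U) = 1 and real numbers a₁ ≥ a₂ ≥ … ≥ a_d ≥ 1 such that U·M·U* = D, where D is the diagonal matrix D = diag(a₁,…,a_d, a₁⁻¹,…,a_d⁻¹, a₁⁻¹,…,a_d⁻¹, a₁,…,a_d) if L = 2d, and D = diag(a₁,…,a_d, 1, a₁⁻¹,…,a_d⁻¹, a₁⁻¹,…,a_d⁻¹, 1, a₁,…,a_d) if L = 2d+1. Moreover D ∈ 𝔾. -/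
open Matrix

noncomputable section

/-- The involution of `{0, …, L−1}` exchanging `i` and `i + (L − d)` for `i < d`,
where `d = ⌊L/2⌋` (it fixes the middle index when `L` is odd). -/
def permIdx (L : ℕ) (i : ℕ) : ℕ :=
  if i < L / 2 then i + (L - L / 2)
  else if L - L / 2 ≤ i then i - (L - L / 2)
  else i

/-- The real symmetric permutation matrix `R` exchanging `e_i` and `e_{L−d+i}` for
`i < d = ⌊L/2⌋` (viewed as a complex matrix). -/
def Rmat (L : ℕ) : Matrix (Fin L) (Fin L) ℂ :=
  Matrix.of fun i j => if (j : ℕ) = permIdx L (i : ℕ) then 1 else 0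

/-- `S = diag(R, R)`. -/
def Smat (L : ℕ) : Matrix (Fin L ⊕ Fin L) (Fin L ⊕ Fin L) ℂ :=
  Matrix.fromBlocks (Rmat L) 0 0 (Rmat L)

/-- The group `𝔾 ≅ SO*(2L)`: matrices `M` with `M* J M = J` and `Mᵀ S M = S`. -/
def Gset (L : ℕ) : Set (Matrix (Fin L ⊕ Fin L) (Fin L ⊕ Fin L) ℂ) :=
  {M | Mᴴ * Jmat L * M = Jmat L ∧ Mᵀ * Smat L * M = Smat L}

/-- The vector of diagonal entries `a₁, …, a_d, (1,) a₁⁻¹, …, a_d⁻¹` (with the middle `1`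
only present when `L` is odd). -/
def dvec (L : ℕ) (A : Fin (L / 2) → ℝ) (i : Fin L) : ℝ :=
  if h : (i : ℕ) < L / 2 then A ⟨i, h⟩
  else if h2 : L - L / 2 ≤ (i : ℕ) then
    (A ⟨(i : ℕ) - (L - L / 2), by have := i.isLt; omega⟩)⁻¹
  else 1

/-- The diagonal matrix `D = diag(a₁,…,a_d,(1,)a₁⁻¹,…,a_d⁻¹,a₁⁻¹,…,a_d⁻¹,(1,)a₁,…,a_d)`. -/
def Dmat (L : ℕ) (A : Fin (L / 2) → ℝ) :
    Matrix (Fin L ⊕ Fin L) (Fin L ⊕ Fin L) ℂ :=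
  Matrix.fromBlocks (Matrix.diagonal fun i => (dvec L A i : ℂ)) 0 0
    (Matrix.diagonal fun i => ((dvec L A i)⁻¹ : ℂ))

open scoped ComplexOrder

section Abstract

variable {E : Type*} [NormedAddCommGroup E] [InnerProductSpace ℂ E]

open scoped InnerProductSpace

/-- A unitary complex structure `J`, a commuting antiunitary involution `K`, and a positive
operator `M` that both of them conjugate to its inverse. -/
structure IsCompatible (J M : E →ₗ[ℂ] E) (K : E →ₗ⋆[ℂ] E) : Prop where
  J_J : ∀ x, J (J x) = -x
  inner_J_J : ∀ x y, ⟪J x, J y⟫_ℂ = ⟪x, y⟫_ℂ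
  K_K : ∀ x, K (K x) = x
  inner_K_K : ∀ x y, ⟪K x, K y⟫_ℂ = ⟪y, x⟫_ℂ
  K_J : ∀ x, K (J x) = J (K x)
  M_symm : M.IsSymmetric
  M_pos : ∀ x, x ≠ 0 → 0 < RCLike.re ⟪x, M x⟫_ℂ
  M_J_M : ∀ x, M (J (M x)) = J x
  M_K_M : ∀ x, M (K (M x)) = K x

/-- A subspace stable under `J`, `K` and `M`. -/
structure IsStable (J M : E →ₗ[ℂ] E) (K : E →ₗ⋆[ℂ] E) (W : Submodule ℂ E) : Prop where
  J_mem : ∀ x ∈ W, J x ∈ W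
  K_mem : ∀ x ∈ W, K x ∈ W
  M_mem : ∀ x ∈ W, M x ∈ W

/-- The span of the orbit of `v` under `J` and `K`. -/
def orbitSpan (J : E →ₗ[ℂ] E) (K : E →ₗ⋆[ℂ] E) (v : E) : Submodule ℂ E :=
  Submodule.span ℂ {v, K v, J v, J (K v)}

/-- Eigenvectors `v i` with eigenvalues `a i ≥ 1` and `K`-fixed vectors `m j` with eigenvalue `1`,
all of norm one, whose orbits under `J` and `K` are orthogonal. -/
structure IsAdapted (J M : E →ₗ[ℂ] E) (K : E →ₗ⋆[ℂ] E) {k r : ℕ}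
    (v : Fin k → E) (a : Fin k → ℝ) (m : Fin r → E) : Prop where
  one_le : ∀ i, 1 ≤ a i
  M_v : ∀ i, M (v i) = (a i : ℂ) • v i
  norm_v : ∀ i, ‖v i‖ = 1
  inner_v_K : ∀ i, ⟪v i, K (v i)⟫_ℂ = 0
  inner_v_J : ∀ i, ⟪v i, J (v i)⟫_ℂ = 0
  orbit_v_v : ∀ i j, i ≠ j → v j ∈ (orbitSpan J K (v i))ᗮ
  orbit_v_m : ∀ i j, m j ∈ (orbitSpan J K (v i))ᗮ
  norm_m : ∀ j, ‖m j‖ = 1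
  K_m : ∀ j, K (m j) = m j
  M_m : ∀ j, M (m j) = m j

variable {J M : E →ₗ[ℂ] E} {K : E →ₗ⋆[ℂ] E}

theorem self_mem_orbitSpan (v : E) : v ∈ orbitSpan J K v :=
  Submodule.subset_span (by simp)

theorem mem_orbitSpan_orthogonal {v y : E} :
    y ∈ (orbitSpan J K v)ᗮ ↔ ⟪v, y⟫_ℂ = 0 ∧ ⟪K v, y⟫_ℂ = 0 ∧ ⟪J v, y⟫_ℂ = 0 ∧ ⟪J (K v), y⟫_ℂ = 0 := by
  constructor
  · intro h
    rw [Submodule.mem_orthogonal] at h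
    refine ⟨h _ ?_, h _ ?_, h _ ?_, h _ ?_⟩ <;> exact Submodule.subset_span (by simp)
  · rintro ⟨h1, h2, h3, h4⟩
    have : orbitSpan J K v ≤ (Submodule.span ℂ {y})ᗮ := by
      refine Submodule.span_le.2 ?_
      intro x hx
      simp only [Set.mem_insert_iff, Set.mem_singleton_iff] at hx
      rw [SetLike.mem_coe, Submodule.mem_orthogonal_singleton_iff_inner_left]
      rcases hx with rfl | rfl | rfl | rfl <;> assumption
    rw [Submodule.mem_orthogonal]
    intro u hu
    exact Submodule.mem_orthogonal_singleton_iff_inner_left.1 (this hu)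

theorem IsStable.orbitSpan_le {W : Submodule ℂ E} (hW : IsStable J M K W) {v : E} (hv : v ∈ W) :
    orbitSpan J K v ≤ W := by
  refine Submodule.span_le.2 ?_
  intro x hx
  simp only [Set.mem_insert_iff, Set.mem_singleton_iff] at hx
  rcases hx with rfl | rfl | rfl | rfl
  exacts [hv, hW.K_mem _ hv, hW.J_mem _ hv, hW.J_mem _ (hW.K_mem _ hv)]

theorem IsCompatible.inner_J_right (h : IsCompatible J M K) (x y : E) :
    ⟪x, J y⟫_ℂ = -⟪J x, y⟫_ℂ := by
  rw [← h.inner_J_J x (J y), h.J_J, inner_neg_right]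

theorem IsCompatible.inner_K_right (h : IsCompatible J M K) (x y : E) :
    ⟪x, K y⟫_ℂ = ⟪y, K x⟫_ℂ := by
  rw [← h.inner_K_K (K y) x, h.K_K]

theorem IsCompatible.norm_J (h : IsCompatible J M K) (x : E) : ‖J x‖ = ‖x‖ := by
  rw [@norm_eq_sqrt_re_inner ℂ, h.inner_J_J, ← norm_eq_sqrt_re_inner]

theorem IsCompatible.norm_K (h : IsCompatible J M K) (x : E) : ‖K x‖ = ‖x‖ := by
  rw [@norm_eq_sqrt_re_inner ℂ, h.inner_K_K, ← norm_eq_sqrt_re_inner]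

theorem IsCompatible.inner_J_K_self (h : IsCompatible J M K) (x : E) : ⟪x, J (K x)⟫_ℂ = 0 := by
  have h1 : ⟪x, J (K x)⟫_ℂ = -⟪x, J (K x)⟫_ℂ := by
    conv_lhs => rw [h.inner_J_right, h.inner_K_right, h.K_J]
  linear_combination h1 / 2

theorem IsCompatible.inner_J_self_of_K_fixed (h : IsCompatible J M K) {x : E} (hx : K x = x) :
    ⟪x, J x⟫_ℂ = 0 := by
  simpa [hx] using h.inner_J_K_self x

theorem IsCompatible.M_K_eigen (h : IsCompatible J M K) {v : E} {a : ℝ} (ha : a ≠ 0)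
    (hv : M v = (a : ℂ) • v) : M (K v) = (a⁻¹ : ℂ) • K v := by
  have := h.M_K_M v
  have ha' : (a : ℂ) ≠ 0 := by exact_mod_cast ha
  rw [hv, LinearMap.map_smulₛₗ, map_smul, Complex.conj_ofReal] at this
  conv_rhs => rw [← this, smul_smul, inv_mul_cancel₀ ha', one_smul]

theorem IsCompatible.M_J_eigen (h : IsCompatible J M K) {v : E} {a : ℝ} (ha : a ≠ 0)
    (hv : M v = (a : ℂ) • v) : M (J v) = (a⁻¹ : ℂ) • J v := by
  have := h.M_J_M v
  have ha' : (a : ℂ) ≠ 0 := by exact_mod_cast ha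
  rw [hv, map_smul, map_smul] at this
  conv_rhs => rw [← this, smul_smul, inv_mul_cancel₀ ha', one_smul]

theorem IsCompatible.M_J_K_eigen (h : IsCompatible J M K) {v : E} {a : ℝ} (ha : a ≠ 0)
    (hv : M v = (a : ℂ) • v) : M (J (K v)) = (a : ℂ) • J (K v) := by
  have := h.M_J_eigen (v := K v) (inv_ne_zero ha) (by simpa using h.M_K_eigen ha hv)
  simpa using this

theorem inner_eq_zero_of_eigen (hM : M.IsSymmetric) {x y : E} {a b : ℝ} (hab : a ≠ b)
    (hx : M x = (a : ℂ) • x) (hy : M y = (b : ℂ) • y) : ⟪x, y⟫_ℂ = 0 := by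
  have h1 := hM x y
  rw [hx, hy, inner_smul_left, inner_smul_right, Complex.conj_ofReal] at h1
  have h2 : ((a : ℂ) - b) ≠ 0 := by
    rw [sub_ne_zero]; exact_mod_cast hab
  exact (mul_eq_zero.1 (by linear_combination h1 : ((a : ℂ) - b) * ⟪x, y⟫_ℂ = 0)).resolve_left h2

theorem IsCompatible.isStable_orbitSpan (h : IsCompatible J M K) {v : E} {a : ℝ} (ha : a ≠ 0)
    (hv : M v = (a : ℂ) • v) : IsStable J M K (orbitSpan J K v) := by
  have m1 : v ∈ orbitSpan J K v := self_mem_orbitSpan v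
  have m2 : K v ∈ orbitSpan J K v := Submodule.subset_span (by simp)
  have m3 : J v ∈ orbitSpan J K v := Submodule.subset_span (by simp)
  have m4 : J (K v) ∈ orbitSpan J K v := Submodule.subset_span (by simp)
  refine ⟨fun x hx => ?_, fun x hx => ?_, fun x hx => ?_⟩
  · suffices orbitSpan J K v ≤ (orbitSpan J K v).comap J from this hx
    refine Submodule.span_le.2 ?_
    rintro y (rfl | rfl | rfl | rfl)
    · exact m3
    · exact m4
    · simpa [h.J_J] using m1
    · simpa [h.J_J] using m2
  · suffices orbitSpan J K v ≤ (orbitSpan J K v).comap K from this hx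
    refine Submodule.span_le.2 ?_
    rintro y (rfl | rfl | rfl | rfl)
    · exact m2
    · simpa [h.K_K] using m1
    · simpa [h.K_J] using m4
    · simpa [h.K_J, h.K_K] using m3
  · suffices orbitSpan J K v ≤ (orbitSpan J K v).comap M from this hx
    refine Submodule.span_le.2 ?_
    rintro y (rfl | rfl | rfl | rfl)
    · simpa only [SetLike.mem_coe, Submodule.mem_comap, hv] using
        Submodule.smul_mem _ _ m1
    · simpa only [SetLike.mem_coe, Submodule.mem_comap, h.M_K_eigen ha hv] using
        Submodule.smul_mem _ _ m2
    · simpa only [SetLike.mem_coe, Submodule.mem_comap, h.M_J_eigen ha hv] using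
        Submodule.smul_mem _ _ m3
    · simpa only [SetLike.mem_coe, Submodule.mem_comap, h.M_J_K_eigen ha hv] using
        Submodule.smul_mem _ _ m4

theorem IsCompatible.isStable_orthogonal_inf (h : IsCompatible J M K) {U W : Submodule ℂ E}
    (hU : IsStable J M K U) (hW : IsStable J M K W) : IsStable J M K (Uᗮ ⊓ W) := by
  refine ⟨fun x hx => ⟨?_, hW.J_mem _ hx.2⟩, fun x hx => ⟨?_, hW.K_mem _ hx.2⟩,
    fun x hx => ⟨?_, hW.M_mem _ hx.2⟩⟩ <;>
  · have hx1 := (Submodule.mem_orthogonal _ _).1 hx.1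
    have hx2 := (Submodule.mem_orthogonal' _ _).1 hx.1
    refine (Submodule.mem_orthogonal _ _).2 fun u hu => ?_
    first
    | rw [h.inner_J_right, hx1 _ (hU.J_mem _ hu), neg_zero]
    | rw [h.inner_K_right, hx2 _ (hU.K_mem _ hu)]
    | rw [← h.M_symm, hx1 _ (hU.M_mem _ hu)]

theorem IsCompatible.orthonormal_orbit (h : IsCompatible J M K) {v : E} (hn : ‖v‖ = 1)
    (hK : ⟪v, K v⟫_ℂ = 0) (hJ : ⟪v, J v⟫_ℂ = 0) :
    Orthonormal ℂ ![v, K v, J v, J (K v)] := by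
  have hv : ⟪v, v⟫_ℂ = 1 := by simp [inner_self_eq_norm_sq_to_K, hn]
  have hK' : ⟪K v, v⟫_ℂ = 0 := inner_eq_zero_symm.1 hK
  have hJ' : ⟪J v, v⟫_ℂ = 0 := inner_eq_zero_symm.1 hJ
  have hT := h.inner_J_K_self v
  have hT' : ⟪J (K v), v⟫_ℂ = 0 := inner_eq_zero_symm.1 hT
  have e1 : ⟪K v, J v⟫_ℂ = 0 := by rw [h.inner_J_right, hT', neg_zero]
  have e2 : ⟪K v, J (K v)⟫_ℂ = 0 := by rw [← h.K_J, h.inner_K_K, hJ']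
  have e1' : ⟪J v, K v⟫_ℂ = 0 := inner_eq_zero_symm.1 e1
  have e2' : ⟪J (K v), K v⟫_ℂ = 0 := inner_eq_zero_symm.1 e2
  rw [orthonormal_iff_ite]
  intro i j
  fin_cases i <;> fin_cases j <;> simp [h.norm_J, h.norm_K, h.inner_J_J, *]

theorem IsCompatible.finrank_orbitSpan (h : IsCompatible J M K) {v : E} (hn : ‖v‖ = 1)
    (hK : ⟪v, K v⟫_ℂ = 0) (hJ : ⟪v, J v⟫_ℂ = 0) :
    Module.finrank ℂ (orbitSpan J K v) = 4 := by
  have h1 := finrank_span_eq_card (h.orthonormal_orbit hn hK hJ).linearIndependent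
  have h2 : Set.range ![v, K v, J v, J (K v)] = {v, K v, J v, J (K v)} := by
    ext y
    simp [Matrix.range_cons]
    tauto
  rw [h2] at h1
  simpa using! h1

theorem IsCompatible.inner_K_self_of_eigen (h : IsCompatible J M K) {v : E} {a : ℝ} (ha : 1 < a)
    (hv : M v = (a : ℂ) • v) : ⟪v, K v⟫_ℂ = 0 ∧ ⟪v, J v⟫_ℂ = 0 := by
  have ha0 : a ≠ 0 := by positivity
  have hne : a ≠ a⁻¹ := (lt_trans (inv_lt_one_of_one_lt₀ ha) ha).ne'
  exact ⟨inner_eq_zero_of_eigen h.M_symm hne hv (by simpa using h.M_K_eigen ha0 hv),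
    inner_eq_zero_of_eigen h.M_symm hne hv (by simpa using h.M_J_eigen ha0 hv)⟩

theorem IsCompatible.eigenvalue_pos (h : IsCompatible J M K) {v : E} {a : ℝ} (hn : ‖v‖ = 1)
    (hv : M v = (a : ℂ) • v) : 0 < a := by
  have h1 := h.M_pos v (by rintro rfl; simp at hn)
  rw [hv, inner_smul_right, inner_self_eq_norm_sq_to_K, hn] at h1
  simpa using h1

/-- Unless `M` is the identity on a stable subspace, it has there an eigenvalue above `1`. -/
theorem IsCompatible.exists_eigen_or_eq_id [FiniteDimensional ℂ E] (h : IsCompatible J M K)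
    {W : Submodule ℂ E} (hW : IsStable J M K W) :
    (∃ v ∈ W, ∃ a : ℝ, 1 < a ∧ ‖v‖ = 1 ∧ M v = (a : ℂ) • v) ∨ ∀ x ∈ W, M x = x := by
  by_cases hex : ∃ v ∈ W, ∃ a : ℝ, a ≠ 1 ∧ ‖v‖ = 1 ∧ M v = (a : ℂ) • v
  · left
    obtain ⟨v, hvW, a, ha, hn, hv⟩ := hex
    have hpos := h.eigenvalue_pos hn hv
    rcases lt_or_gt_of_ne ha with hlt | hgt
    · refine ⟨J v, hW.J_mem _ hvW, a⁻¹, (one_lt_inv₀ hpos).2 hlt, ?_, ?_⟩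
      · rw [h.norm_J, hn]
      · simpa using h.M_J_eigen hpos.ne' hv
    · exact ⟨v, hvW, a, hgt, hn, hv⟩
  · right
    push Not at hex
    have hs : (M.restrict hW.M_mem).IsSymmetric := h.M_symm.restrict_invariant hW.M_mem
    have key : M.restrict hW.M_mem = LinearMap.id := by
      refine (hs.eigenvectorBasis rfl).toBasis.ext fun i => ?_
      rw [OrthonormalBasis.coe_toBasis]
      have h1 := hs.apply_eigenvectorBasis rfl i
      have h2 : hs.eigenvalues rfl i = 1 := by
        by_contra hne
        refine hex _ (hs.eigenvectorBasis rfl i).2 _ hne ?_ ?_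
        · exact (hs.eigenvectorBasis rfl).orthonormal.1 i
        · exact congrArg Subtype.val h1
      rw [h1, h2]; simp
    intro x hx
    exact congrArg Subtype.val (LinearMap.congr_fun key ⟨x, hx⟩)

theorem IsCompatible.exists_K_fixed (h : IsCompatible J M K) {W : Submodule ℂ E}
    (hW : IsStable J M K W) (hne : W ≠ ⊥) : ∃ m ∈ W, ‖m‖ = 1 ∧ K m = m := by
  suffices ∃ m ∈ W, m ≠ 0 ∧ K m = m by
    obtain ⟨m, hm, h0, hK⟩ := this
    refine ⟨((‖m‖⁻¹ : ℝ) : ℂ) • m, W.smul_mem _ hm, ?_, ?_⟩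
    · simp [norm_smul, h0]
    · rw [LinearMap.map_smulₛₗ, hK, Complex.conj_ofReal]
  obtain ⟨w, hw, h0⟩ := W.ne_bot_iff.1 hne
  by_cases hs : w + K w = 0
  · refine ⟨Complex.I • w, W.smul_mem _ hw, by simp [h0], ?_⟩
    rw [LinearMap.map_smulₛₗ, eq_neg_of_add_eq_zero_right hs]
    simp
  · exact ⟨_, W.add_mem hw (hW.K_mem _ hw), hs, by rw [map_add, h.K_K, add_comm]⟩

theorem IsCompatible.exists_eigen_of_four_le [FiniteDimensional ℂ E] (h : IsCompatible J M K)
    {W : Submodule ℂ E} (hW : IsStable J M K W) (hd : 4 ≤ Module.finrank ℂ W) :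
    ∃ v ∈ W, ∃ a : ℝ, 1 ≤ a ∧ ‖v‖ = 1 ∧ M v = (a : ℂ) • v ∧ ⟪v, K v⟫_ℂ = 0 ∧
      ⟪v, J v⟫_ℂ = 0 := by
  rcases h.exists_eigen_or_eq_id hW with ⟨v, hvW, a, ha, hn, hv⟩ | hid
  · exact ⟨v, hvW, a, ha.le, hn, hv, h.inner_K_self_of_eigen ha hv⟩
  · obtain ⟨m, hmW, hmn, hmK⟩ := h.exists_K_fixed hW
      (by rintro rfl; simp at hd)
    have hst : IsStable J M K (orbitSpan J K m) :=
      h.isStable_orbitSpan one_ne_zero (by simpa using hid m hmW)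
    have hle : Module.finrank ℂ (orbitSpan J K m) ≤ 2 := by
      have : orbitSpan J K m = Submodule.span ℂ (Set.range ![m, J m]) := by
        simp [orbitSpan, hmK, Matrix.range_cons, Set.pair_comm]
      rw [this]
      exact (finrank_range_le_card _).trans (by simp)
    have hadd := Submodule.finrank_add_inf_finrank_orthogonal (hst.orbitSpan_le
      (self_mem_orbitSpan m) |>.trans (hW.orbitSpan_le hmW))
    obtain ⟨n, ⟨hnm, hnW⟩, hnn, hnK⟩ := h.exists_K_fixed (h.isStable_orthogonal_inf hst hW)
      (by intro hbot; rw [hbot, finrank_bot] at hadd; omega)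
    obtain ⟨o1, -, o2, -⟩ := mem_orbitSpan_orthogonal.1 hnm
    have o1' := inner_eq_zero_symm.1 o1
    have o3 : ⟪m, J n⟫_ℂ = 0 := by rw [h.inner_J_right, o2, neg_zero]
    have o4 : ⟪n, J m⟫_ℂ = 0 := inner_eq_zero_symm.1 o2
    have hmm : ⟪m, m⟫_ℂ = 1 := by simp [inner_self_eq_norm_sq_to_K, hmn]
    have hnn' : ⟪n, n⟫_ℂ = 1 := by simp [inner_self_eq_norm_sq_to_K, hnn]
    have hmJ := h.inner_J_self_of_K_fixed hmK
    have hnJ := h.inner_J_self_of_K_fixed hnK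
    have hs : ((√2 : ℝ) : ℂ) * (√2 : ℝ) = 2 := by
      rw [← Complex.ofReal_mul, Real.mul_self_sqrt (by norm_num)]; norm_num
    set c : ℂ := (((√2)⁻¹ : ℝ) : ℂ) with hc
    have hcc : c * c = 1 / 2 := by
      rw [hc, Complex.ofReal_inv, ← mul_inv, hs]; norm_num
    have hvW : c • (m + Complex.I • n) ∈ W :=
      W.smul_mem _ (W.add_mem hmW (W.smul_mem _ hnW))
    have hcs : (starRingEnd ℂ) c = c := Complex.conj_ofReal _
    refine ⟨_, hvW, 1, le_rfl, ?_, by simpa using hid _ hvW, ?_, ?_⟩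
    · have : ⟪c • (m + Complex.I • n), c • (m + Complex.I • n)⟫_ℂ = 1 := by
        simp only [inner_smul_left, inner_smul_right, inner_add_left, inner_add_right, hcs, o1,
          o1', hmm, hnn', Complex.conj_I]
        linear_combination (1 - Complex.I * Complex.I) * hcc - (1/2) * Complex.I_mul_I
      rw [@norm_eq_sqrt_re_inner ℂ, this]; simp
    · rw [LinearMap.map_smulₛₗ, map_add, LinearMap.map_smulₛₗ, hmK, hnK]
      simp only [inner_smul_left, inner_smul_right, inner_add_left, inner_add_right, hcs, o1,
          o1', hmm, hnn', Complex.conj_I]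
      linear_combination (c * c) * Complex.I_mul_I
    · simp only [map_smul, map_add, inner_smul_left, inner_smul_right, inner_add_left,
        inner_add_right, hmJ, hnJ, o3, o4]
      ring

theorem IsCompatible.exists_isAdapted [FiniteDimensional ℂ E] (h : IsCompatible J M K)
    {r : ℕ} (hr : r ≤ 1) (k : ℕ) {W : Submodule ℂ E} (hW : IsStable J M K W)
    (hd : Module.finrank ℂ W = 4 * k + 2 * r) :
    ∃ (v : Fin k → E) (a : Fin k → ℝ) (m : Fin r → E), IsAdapted J M K v a m ∧
      (∀ i, v i ∈ W) ∧ ∀ j, m j ∈ W := by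
  induction k generalizing W with
  | zero =>
    suffices ∃ m : Fin r → E, ∀ j, m j ∈ W ∧ ‖m j‖ = 1 ∧ K (m j) = m j ∧ M (m j) = m j by
      obtain ⟨m, hm⟩ := this
      refine ⟨Fin.elim0, Fin.elim0, m, ?_, fun i => i.elim0, fun j => (hm j).1⟩
      constructor
      all_goals first | exact fun i => i.elim0 | skip
      exacts [fun j => (hm j).2.1, fun j => (hm j).2.2.1, fun j => (hm j).2.2.2]
    rcases Nat.le_one_iff_eq_zero_or_eq_one.1 hr with rfl | rfl
    · exact ⟨Fin.elim0, fun j => j.elim0⟩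
    · rcases h.exists_eigen_or_eq_id hW with ⟨v, hvW, a, ha, hn, hv⟩ | hid
      · have h4 := h.finrank_orbitSpan hn (h.inner_K_self_of_eigen ha hv).1
          (h.inner_K_self_of_eigen ha hv).2
        have := Submodule.finrank_mono (hW.orbitSpan_le hvW)
        omega
      · obtain ⟨m, hmW, hmn, hmK⟩ := h.exists_K_fixed hW
          (by rintro rfl; simp at hd)
        exact ⟨fun _ => m, fun _ => ⟨hmW, hmn, hmK, hid m hmW⟩⟩
  | succ k ih =>
    obtain ⟨w, hwW, b, hb, hwn, hwM, hwK, hwJ⟩ := h.exists_eigen_of_four_le hW (by omega)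
    have hst : IsStable J M K (orbitSpan J K w) := h.isStable_orbitSpan (by positivity) hwM
    have hW' := h.isStable_orthogonal_inf hst hW
    have hadd := Submodule.finrank_add_inf_finrank_orthogonal (hW.orbitSpan_le hwW)
    rw [h.finrank_orbitSpan hwn hwK hwJ] at hadd
    obtain ⟨v, a, m, hA, hv, hm⟩ := ih hW' (by omega)
    refine ⟨Fin.cons w v, Fin.cons b a, m, ?_, ?_, fun j => (hm j).2⟩
    · constructor
      · exact Fin.cases hb hA.one_le
      · exact Fin.cases hwM hA.M_v
      · exact Fin.cases hwn hA.norm_v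
      · exact Fin.cases hwK hA.inner_v_K
      · exact Fin.cases hwJ hA.inner_v_J
      · intro i j hij
        induction i using Fin.cases with
        | zero =>
          induction j using Fin.cases with
          | zero => exact absurd rfl hij
          | succ j => exact (hv j).1
        | succ i =>
          induction j using Fin.cases with
          | zero =>
            refine (Submodule.mem_orthogonal' _ _).2 fun u hu => ?_
            exact (Submodule.mem_orthogonal _ _).1 (hW'.orbitSpan_le (hv i) hu).1 _
              (self_mem_orbitSpan w)
          | succ j => exact hA.orbit_v_v i j fun e => hij (congrArg _ e)
      · exact Fin.cases (fun j => (hm j).1) hA.orbit_v_m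
      exacts [hA.norm_m, hA.K_m, hA.M_m]
    · exact Fin.cases hwW fun i => (hv i).2

theorem IsAdapted.inner_v_v {k r : ℕ} {v : Fin k → E} {a : Fin k → ℝ} {m : Fin r → E}
    (hA : IsAdapted J M K v a m) (i j : Fin k) : ⟪v i, v j⟫_ℂ = if i = j then 1 else 0 := by
  split_ifs with hij
  · simp [hij, inner_self_eq_norm_sq_to_K, hA.norm_v]
  · exact (mem_orbitSpan_orthogonal.1 (hA.orbit_v_v i j hij)).1

theorem IsAdapted.inner_K_v_v (h : IsCompatible J M K) {k r : ℕ} {v : Fin k → E} {a : Fin k → ℝ}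
    {m : Fin r → E} (hA : IsAdapted J M K v a m) (i j : Fin k) :
    ⟪K (v i), v j⟫_ℂ = 0 ∧ ⟪J (v i), v j⟫_ℂ = 0 ∧ ⟪J (K (v i)), v j⟫_ℂ = 0 := by
  by_cases hij : i = j
  · subst hij
    exact ⟨inner_eq_zero_symm.1 (hA.inner_v_K i), inner_eq_zero_symm.1 (hA.inner_v_J i),
      inner_eq_zero_symm.1 (h.inner_J_K_self _)⟩
  · exact (mem_orbitSpan_orthogonal.1 (hA.orbit_v_v i j hij)).2

theorem IsAdapted.comp_equiv {k r : ℕ} {v : Fin k → E} {a : Fin k → ℝ} {m : Fin r → E}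
    (hA : IsAdapted J M K v a m) (e : Equiv.Perm (Fin k)) :
    IsAdapted J M K (v ∘ e) (a ∘ e) m where
  one_le _ := hA.one_le _
  M_v _ := hA.M_v _
  norm_v _ := hA.norm_v _
  inner_v_K _ := hA.inner_v_K _
  inner_v_J _ := hA.inner_v_J _
  orbit_v_v _ _ hij := hA.orbit_v_v _ _ fun he => hij (e.injective he)
  orbit_v_m _ _ := hA.orbit_v_m _ _
  norm_m := hA.norm_m
  K_m := hA.K_m
  M_m := hA.M_m

/-- The vectors `v₁, …, v_d, (m,) K v₁, …, K v_d`. -/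
def frame (K : E →ₗ⋆[ℂ] E) (L : ℕ) (v : Fin (L / 2) → E) (m : Fin (L % 2) → E) (i : Fin L) : E :=
  if h : (i : ℕ) < L / 2 then v ⟨i, h⟩
  else if h2 : L - L / 2 ≤ (i : ℕ) then
    K (v ⟨(i : ℕ) - (L - L / 2), by have := i.isLt; omega⟩)
  else m ⟨0, by omega⟩

theorem frame_cases (K : E →ₗ⋆[ℂ] E) {L : ℕ} (v : Fin (L / 2) → E) (m : Fin (L % 2) → E)
    (i : Fin L) :
    (∃ k : Fin (L / 2), (i : ℕ) = k ∧ frame K L v m i = v k) ∨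
    (∃ k : Fin (L / 2), (i : ℕ) = k + (L - L / 2) ∧ frame K L v m i = K (v k)) ∨
    (∃ b : Fin (L % 2), (i : ℕ) = L / 2 ∧ L / 2 < L - L / 2 ∧ frame K L v m i = m b) := by
  unfold frame
  split_ifs with h1 h2
  · exact Or.inl ⟨_, rfl, rfl⟩
  · exact Or.inr (Or.inl ⟨_, by simp only; omega, rfl⟩)
  · exact Or.inr (Or.inr ⟨_, by omega, by omega, rfl⟩)

theorem permIdx_lt {L i : ℕ} (hi : i < L) : permIdx L i < L := by
  unfold permIdx; split_ifs <;> omega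

theorem permIdx_permIdx {L i : ℕ} (hi : i < L) : permIdx L (permIdx L i) = i := by
  unfold permIdx; split_ifs <;> omega

theorem IsAdapted.K_frame (h : IsCompatible J M K) {L : ℕ} {v : Fin (L / 2) → E}
    {a : Fin (L / 2) → ℝ} {m : Fin (L % 2) → E} (hA : IsAdapted J M K v a m) (i : Fin L) :
    K (frame K L v m i) = frame K L v m ⟨permIdx L i, permIdx_lt i.2⟩ := by
  have := i.2
  by_cases h1 : (i : ℕ) < L / 2
  · have h2 : permIdx L i = i + (L - L / 2) := by unfold permIdx; rw [if_pos h1]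
    simp only [frame, h2]
    rw [dif_pos h1, dif_neg (by omega), dif_pos (by omega)]
    simp
  · by_cases h3 : L - L / 2 ≤ (i : ℕ)
    · have h2 : permIdx L i = i - (L - L / 2) := by
        unfold permIdx; rw [if_neg h1, if_pos h3]
      simp only [frame, h2]
      rw [dif_neg h1, dif_pos h3, dif_pos (by omega), h.K_K]
    · have h2 : permIdx L i = i := by unfold permIdx; rw [if_neg h1, if_neg h3]
      simp only [frame, h2]
      rw [dif_neg h1, dif_neg h3, hA.K_m]

theorem IsAdapted.M_frame (h : IsCompatible J M K) {L : ℕ} {v : Fin (L / 2) → E}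
    {a : Fin (L / 2) → ℝ} {m : Fin (L % 2) → E} (hA : IsAdapted J M K v a m) (i : Fin L) :
    M (frame K L v m i) = (dvec L a i : ℂ) • frame K L v m i := by
  unfold frame dvec
  split_ifs with h1 h2
  · exact hA.M_v _
  · rw [h.M_K_eigen (zero_lt_one.trans_le (hA.one_le _)).ne' (hA.M_v _), Complex.ofReal_inv]
  · rw [hA.M_m, Complex.ofReal_one, one_smul]

theorem IsAdapted.inner_frame (h : IsCompatible J M K) {L : ℕ} {v : Fin (L / 2) → E}
    {a : Fin (L / 2) → ℝ} {m : Fin (L % 2) → E} (hA : IsAdapted J M K v a m) (i j : Fin L) :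
    ⟪frame K L v m i, frame K L v m j⟫_ℂ = if i = j then 1 else 0 := by
  have hvm := fun i j => mem_orbitSpan_orthogonal.1 (hA.orbit_v_m i j)
  have hmv := fun i j => inner_eq_zero_symm.1 (hvm i j).1
  have hmK := fun i j => inner_eq_zero_symm.1 (hvm i j).2.1
  have hvK := fun i j => inner_eq_zero_symm.1 (hA.inner_K_v_v h i j).1
  rcases frame_cases K v m i with ⟨k, hi, ei⟩ | ⟨k, hi, ei⟩ | ⟨k, hi, hi', ei⟩ <;>
  rcases frame_cases K v m j with ⟨l, hj, ej⟩ | ⟨l, hj, ej⟩ | ⟨l, hj, hj', ej⟩ <;>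
  rw [ei, ej]
  · rw [hA.inner_v_v]; simp only [Fin.ext_iff, hi, hj]
  · rw [hvK, if_neg (by rw [Fin.ext_iff]; omega)]
  · rw [(hvm _ _).1, if_neg (by rw [Fin.ext_iff]; omega)]
  · rw [(hA.inner_K_v_v h _ _).1, if_neg (by rw [Fin.ext_iff]; omega)]
  · rw [h.inner_K_K, hA.inner_v_v]
    simp only [Fin.ext_iff, hi, hj, Nat.add_right_cancel_iff, eq_comm]
  · rw [(hvm _ _).2.1, if_neg (by rw [Fin.ext_iff]; omega)]
  · rw [hmv, if_neg (by rw [Fin.ext_iff]; omega)]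
  · rw [hmK, if_neg (by rw [Fin.ext_iff]; omega)]
  · have hkl : k = l := Fin.ext (by omega)
    rw [if_pos (by rw [Fin.ext_iff]; omega), hkl]
    simp [inner_self_eq_norm_sq_to_K, hA.norm_m]

theorem IsAdapted.inner_J_frame (h : IsCompatible J M K) {L : ℕ} {v : Fin (L / 2) → E}
    {a : Fin (L / 2) → ℝ} {m : Fin (L % 2) → E} (hA : IsAdapted J M K v a m) (i j : Fin L) :
    ⟪J (frame K L v m i), frame K L v m j⟫_ℂ = 0 := by
  have hvm := fun i j => mem_orbitSpan_orthogonal.1 (hA.orbit_v_m i j)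
  have hJ := fun i j => (hA.inner_K_v_v h i j).2.1
  have hJK := fun i j => (hA.inner_K_v_v h i j).2.2
  have hswap : ∀ x y, ⟪J x, y⟫_ℂ = 0 → ⟪J y, x⟫_ℂ = 0 := fun x y hxy =>
    inner_eq_zero_symm.1 (by rw [h.inner_J_right, hxy, neg_zero])
  rcases frame_cases K v m i with ⟨k, hi, ei⟩ | ⟨k, hi, ei⟩ | ⟨k, hi, hi', ei⟩ <;>
  rcases frame_cases K v m j with ⟨l, hj, ej⟩ | ⟨l, hj, ej⟩ | ⟨l, hj, hj', ej⟩ <;>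
  rw [ei, ej]
  · exact hJ _ _
  · exact hswap _ _ (hJK _ _)
  · exact (hvm _ _).2.2.1
  · exact hJK _ _
  · rw [← h.K_J, h.inner_K_K]
    exact inner_eq_zero_symm.1 (hJ _ _)
  · exact (hvm _ _).2.2.2
  · exact hswap _ _ (hvm _ _).2.2.1
  · exact hswap _ _ (hvm _ _).2.2.2
  · have hkl : k = l := Fin.ext (by omega)
    rw [hkl]
    exact inner_eq_zero_symm.1 (h.inner_J_self_of_K_fixed (hA.K_m l))

end Abstract

section Concrete

variable {L : ℕ}

theorem Jmat_mul_Jmat : Jmat L * Jmat L = -1 := by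
  simp [Jmat, fromBlocks_multiply, ← fromBlocks_one, fromBlocks_neg]

theorem conjTranspose_Jmat : (Jmat L)ᴴ = -Jmat L := by
  simp [Jmat, fromBlocks_conjTranspose, fromBlocks_neg]

theorem Rmat_apply (i j : Fin L) :
    Rmat L i j = if i = ⟨permIdx L j, permIdx_lt j.2⟩ then 1 else 0 := by
  have hiff : ((j : ℕ) = permIdx L i) ↔ i = ⟨permIdx L j, permIdx_lt j.2⟩ := by
    rw [Fin.ext_iff]
    constructor
    · intro e; simp only [e, permIdx_permIdx i.2]
    · intro e; rw [e]; exact (permIdx_permIdx j.2).symm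
  simp only [Rmat, of_apply, hiff]

theorem Rmat_transpose : (Rmat L)ᵀ = Rmat L := by
  ext i j
  rw [transpose_apply, Rmat_apply]
  simp only [Rmat, of_apply, Fin.ext_iff]

theorem Rmat_conjTranspose : (Rmat L)ᴴ = Rmat L := by
  rw [conjTranspose, Rmat_transpose]
  ext i j
  simp [Rmat, apply_ite]

theorem Rmat_mul_Rmat : Rmat L * Rmat L = 1 := by
  ext i j
  simp only [mul_apply, Rmat_apply _ j, mul_ite, mul_one, mul_zero, Finset.sum_ite_eq',
    Finset.mem_univ, if_true]
  rw [Rmat_apply, one_apply]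
  simp only [permIdx_permIdx j.2]

theorem Smat_transpose : (Smat L)ᵀ = Smat L := by
  simp [Smat, fromBlocks_transpose, Rmat_transpose]

theorem Smat_conjTranspose : (Smat L)ᴴ = Smat L := by
  simp [Smat, fromBlocks_conjTranspose, Rmat_conjTranspose]

theorem Smat_mul_Smat : Smat L * Smat L = 1 := by
  simp [Smat, fromBlocks_multiply, Rmat_mul_Rmat]

theorem Smat_mul_Jmat : Smat L * Jmat L = Jmat L * Smat L := by
  simp [Smat, Jmat, fromBlocks_multiply]

theorem star_Smat_mulVec (x : Fin L ⊕ Fin L → ℂ) : star (Smat L *ᵥ x) = Smat L *ᵥ star x := by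
  rw [star_mulVec, ← mulVec_transpose, Smat_conjTranspose, Smat_transpose]

/-- The antiunitary involution `x ↦ S x̄`. -/
def conjS (L : ℕ) : EuclideanSpace ℂ (Fin L ⊕ Fin L) →ₗ⋆[ℂ] EuclideanSpace ℂ (Fin L ⊕ Fin L) where
  toFun x := WithLp.toLp 2 (Smat L *ᵥ star x.ofLp)
  map_add' x y := by simp [mulVec_add]
  map_smul' c x := by simp [mulVec_smul]

theorem mul_Smat_mul_transpose {M : Matrix (Fin L ⊕ Fin L) (Fin L ⊕ Fin L) ℂ}
    (hM : Mᵀ * Smat L * M = Smat L) : M * Smat L * Mᵀ = Smat L := by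
  have h1 : (Smat L * Mᵀ * Smat L) * M = 1 := by
    rw [Matrix.mul_assoc, Matrix.mul_assoc, ← Matrix.mul_assoc (Mᵀ), hM, Smat_mul_Smat]
  have h2 := congrArg (· * Smat L) (mul_eq_one_comm.1 h1)
  simpa [Matrix.mul_assoc, Smat_mul_Smat] using h2

theorem isCompatible_of_mem_Gset {M : Matrix (Fin L ⊕ Fin L) (Fin L ⊕ Fin L) ℂ}
    (hM : M ∈ Gset L) (hMpos : M.PosDef) :
    IsCompatible (toEuclideanLin (Jmat L)) (toEuclideanLin M) (conjS L) where
  J_J x := by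
    ext1
    simp [toLpLin_apply, Jmat_mul_Jmat, neg_mulVec]
  inner_J_J x y := by
    simp only [EuclideanSpace.inner_eq_star_dotProduct, toLpLin_apply]
    rw [star_mulVec, dotProduct_comm, ← dotProduct_mulVec, mulVec_mulVec, conjTranspose_Jmat,
      Matrix.neg_mul, Jmat_mul_Jmat, neg_neg, one_mulVec, dotProduct_comm]
  K_K x := by
    ext1
    simp [conjS, star_Smat_mulVec, Smat_mul_Smat]
  inner_K_K x y := by
    simp only [EuclideanSpace.inner_eq_star_dotProduct, conjS, LinearMap.coe_mk, AddHom.coe_mk]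
    rw [star_Smat_mulVec, star_star, dotProduct_mulVec, vecMul_mulVec, Smat_transpose,
      Smat_mul_Smat, vecMul_one, dotProduct_comm]
  K_J x := by
    ext1
    have hJ : star (Jmat L *ᵥ x.ofLp) = Jmat L *ᵥ star x.ofLp := by
      rw [star_mulVec, ← mulVec_transpose]
      congr 1
      simp [Jmat, fromBlocks_conjTranspose, fromBlocks_transpose]
    simp [conjS, toLpLin_apply, hJ, Smat_mul_Jmat]
  M_symm := isSymmetric_toEuclideanLin_iff.2 hMpos.1
  M_pos x hx := by
    have h1 := hMpos.dotProduct_mulVec_pos (x := x.ofLp) (by simpa using hx)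
    rw [EuclideanSpace.inner_eq_star_dotProduct, dotProduct_comm]
    exact (Complex.pos_iff.1 h1).1
  M_J_M x := by
    have h1 := hM.1
    rw [hMpos.1.eq] at h1
    ext1
    simp [toLpLin_apply, ← Matrix.mul_assoc, h1]
  M_K_M x := by
    have h1 : star (M *ᵥ x.ofLp) = Mᵀ *ᵥ star x.ofLp := by
      rw [star_mulVec, hMpos.1.eq, mulVec_transpose]
    ext1
    simp [conjS, toLpLin_apply, h1, ← Matrix.mul_assoc, mul_Smat_mul_transpose hM.2]

theorem Gset_mul_mem {A B : Matrix (Fin L ⊕ Fin L) (Fin L ⊕ Fin L) ℂ} (hA : A ∈ Gset L)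
    (hB : B ∈ Gset L) : A * B ∈ Gset L := by
  constructor
  · calc (A * B)ᴴ * Jmat L * (A * B) = Bᴴ * (Aᴴ * Jmat L * A) * B := by
          simp only [conjTranspose_mul, Matrix.mul_assoc]
      _ = Jmat L := by rw [hA.1, hB.1]
  · calc (A * B)ᵀ * Smat L * (A * B) = Bᵀ * (Aᵀ * Smat L * A) * B := by
          simp only [transpose_mul, Matrix.mul_assoc]
      _ = Smat L := by rw [hA.2, hB.2]

theorem mem_Gset_of_unitary {V : Matrix (Fin L ⊕ Fin L) (Fin L ⊕ Fin L) ℂ} (hV : Vᴴ * V = 1)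
    (hJ : Jmat L * V = V * Jmat L) (hS : Smat L * V.map star = V * Smat L) : V ∈ Gset L := by
  refine ⟨by rw [Matrix.mul_assoc, hJ, ← Matrix.mul_assoc, hV, Matrix.one_mul], ?_⟩
  have h1 : Vᵀ * Smat L = Smat L * Vᴴ := by
    have h2 := congrArg conjTranspose hS
    have h3 : (V.map star)ᴴ = Vᵀ := by ext i j; simp
    rwa [conjTranspose_mul, conjTranspose_mul, Smat_conjTranspose, h3] at h2
  rw [h1, Matrix.mul_assoc, hV, Matrix.mul_one]

theorem conjTranspose_mem_Gset_of_unitary {V : Matrix (Fin L ⊕ Fin L) (Fin L ⊕ Fin L) ℂ}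
    (hV : Vᴴ * V = 1) (hJ : Jmat L * V = V * Jmat L) (hS : Smat L * V.map star = V * Smat L) :
    Vᴴ ∈ Gset L := by
  have hV' : V * Vᴴ = 1 := mul_eq_one_comm.1 hV
  refine ⟨by rw [conjTranspose_conjTranspose, ← hJ, Matrix.mul_assoc, hV', Matrix.mul_one], ?_⟩
  have h1 : Vᴴᵀ * Smat L = Smat L * V := by
    have h2 := congrArg (fun X => Smat L * X * Smat L) hS
    simpa only [Matrix.mul_assoc, Smat_mul_Smat, Matrix.mul_one, ← Matrix.mul_assoc (Smat L)
      (Smat L), Matrix.one_mul] using! h2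
  rw [h1, Matrix.mul_assoc, hV', Matrix.mul_one]

theorem det_eq_one_of_unitary {V : Matrix (Fin L ⊕ Fin L) (Fin L ⊕ Fin L) ℂ} (hV : Vᴴ * V = 1)
    (hJ : Jmat L * V = V * Jmat L) (hS : Smat L * V.map star = V * Smat L) : V.det = 1 := by
  obtain ⟨A, B, C, D, rfl⟩ : ∃ A B C D, V = fromBlocks A B C D :=
    ⟨_, _, _, _, (fromBlocks_toBlocks V).symm⟩
  simp only [Jmat, Smat, fromBlocks_multiply, fromBlocks_map, fromBlocks_inj, Matrix.zero_mul,
    Matrix.mul_zero, zero_add, add_zero, Matrix.one_mul, Matrix.mul_one, Matrix.neg_mul,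
    Matrix.mul_neg] at hJ hS
  obtain ⟨hCB, hDA, -, -⟩ := hJ
  obtain ⟨hA, -, hC, -⟩ := hS
  have hB : B = -C := by rw [← hCB]
  have hD : D = A := neg_injective hDA
  subst hB hD
  have hfac : fromBlocks 1 (Complex.I • 1) 0 1 * fromBlocks D (-C) C D *
      fromBlocks 1 (-Complex.I • 1) 0 1 =
      fromBlocks (D + Complex.I • C) 0 C (D - Complex.I • C) := by
    simp [fromBlocks_multiply, smul_smul, sub_eq_add_neg, add_comm]
  have hdet := congrArg det hfac
  rw [det_mul, det_mul, det_fromBlocks_zero₂₁, det_fromBlocks_zero₂₁, det_fromBlocks_zero₁₂] at hdet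
  simp only [det_one, mul_one, one_mul] at hdet
  have hconj : Rmat L * (D + Complex.I • C).map star = (D - Complex.I • C) * Rmat L := by
    rw [Matrix.sub_mul, Matrix.smul_mul, ← hA, ← hC]
    ext i j
    simp [mul_apply, mul_add, Finset.sum_add_distrib, Finset.mul_sum, mul_left_comm]
    ring
  have hR : (Rmat L).det ≠ 0 := by
    intro h0
    have := congrArg det (Rmat_mul_Rmat (L := L))
    simp [h0] at this
  have hdet2 := congrArg det hconj
  rw [det_mul, det_mul, mul_comm] at hdet2
  have hdet3 := mul_right_cancel₀ hR hdet2
  have hdet4 : ((D + Complex.I • C).map star).det = star (D + Complex.I • C).det := by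
    rw [← det_conjTranspose, ← det_transpose]; rfl
  rw [← hdet3, hdet4] at hdet
  have hunit := congrArg det hV
  rw [det_mul, det_conjTranspose, det_one, hdet] at hunit
  rw [hdet]
  generalize (D + Complex.I • C).det = z at hunit ⊢
  have hz : z * star z = ((Complex.normSq z : ℝ) : ℂ) := Complex.mul_conj z
  rw [hz] at hunit ⊢
  have h1 : Complex.normSq z * Complex.normSq z = 1 := by
    have : star ((Complex.normSq z : ℝ) : ℂ) = (Complex.normSq z : ℝ) := Complex.conj_ofReal _
    rw [this] at hunit
    exact_mod_cast hunit
  have h2 : Complex.normSq z = 1 := by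
    nlinarith [Complex.normSq_nonneg z]
  rw [h2, Complex.ofReal_one]

/-- The matrix with columns `u i` and `J (u i)`. -/
def frameMatrix (u : Fin L → EuclideanSpace ℂ (Fin L ⊕ Fin L)) :
    Matrix (Fin L ⊕ Fin L) (Fin L ⊕ Fin L) ℂ :=
  of fun p q => Sum.elim u (fun i => toEuclideanLin (Jmat L) (u i)) q p

theorem mul_frameMatrix_apply (A : Matrix (Fin L ⊕ Fin L) (Fin L ⊕ Fin L) ℂ)
    (u : Fin L → EuclideanSpace ℂ (Fin L ⊕ Fin L)) (p q : Fin L ⊕ Fin L) :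
    (A * frameMatrix u) p q =
      toEuclideanLin A (Sum.elim u (fun i => toEuclideanLin (Jmat L) (u i)) q) p := rfl

end Concrete

/-- diagonalization of positive elements of `𝔾`: a positive definite
`M ∈ 𝔾` can be diagonalized as `U M U* = D` by a unitary `U ∈ 𝔾` with `det U = 1`,
where `D = Dmat L a` with `a₁ ≥ … ≥ a_d ≥ 1`, and moreover `D ∈ 𝔾`. -/
theorem Gset_posDef_diagonalization (L : ℕ) (hL : 0 < L)
    (M : Matrix (Fin L ⊕ Fin L) (Fin L ⊕ Fin L) ℂ)
    (hM : M ∈ Gset L) (hMpos : M.PosDef) :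
    ∃ (U : Matrix (Fin L ⊕ Fin L) (Fin L ⊕ Fin L) ℂ) (a : Fin (L / 2) → ℝ),
      U ∈ Gset L ∧ Uᴴ * U = 1 ∧ U.det = 1 ∧
      (∀ i j : Fin (L / 2), i ≤ j → a j ≤ a i) ∧ (∀ i, 1 ≤ a i) ∧
      U * M * Uᴴ = Dmat L a ∧ Dmat L a ∈ Gset L := by
  have h := isCompatible_of_mem_Gset hM hMpos
  obtain ⟨v', a', m, hA', -, -⟩ := h.exists_isAdapted (r := L % 2) (by omega) (L / 2)
    (W := ⊤) ⟨by simp, by simp, by simp⟩ (by simp; omega)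
  set e := Tuple.sort (fun i => -a' i)
  have hA := hA'.comp_equiv e
  have hanti : ∀ i j, i ≤ j → (a' ∘ e) j ≤ (a' ∘ e) i := fun i j hij =>
    neg_le_neg_iff.1 (Tuple.monotone_sort (fun i => -a' i) hij)
  generalize v' ∘ e = v at hA
  generalize a' ∘ e = a at hA hanti
  set u := frame (conjS L) L v m with hu
  set V := frameMatrix u with hVdef
  have hVl : ∀ p j, V p (Sum.inl j) = u j p := fun _ _ => rfl
  have hVr : ∀ p j, V p (Sum.inr j) = toEuclideanLin (Jmat L) (u j) p := fun _ _ => rfl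
  have hV : Vᴴ * V = 1 := by
    have hgram : ∀ p q, (Vᴴ * V) p q =
        inner ℂ (Sum.elim u (fun i => toEuclideanLin (Jmat L) (u i)) p)
          (Sum.elim u (fun i => toEuclideanLin (Jmat L) (u i)) q) := by
      intro p q
      rw [EuclideanSpace.inner_eq_star_dotProduct, dotProduct_comm]
      rfl
    ext p q
    rw [hgram, one_apply]
    rcases p with i | i <;> rcases q with j | j
    · simpa using hA.inner_frame h i j
    · simpa using inner_eq_zero_symm.1 (hA.inner_J_frame h j i)
    · simpa using hA.inner_J_frame h i j
    · simpa [h.inner_J_J] using hA.inner_frame h i j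
  have hJ : Jmat L * V = V * Jmat L := by
    ext p q
    rw [hVdef, mul_frameMatrix_apply, ← hVdef]
    rcases q with j | j
    · simp [mul_apply, Jmat, one_apply, hVr]
    · rw [Sum.elim_inr, h.J_J]
      simp [mul_apply, Jmat, one_apply, hVl]
  have hS : Smat L * V.map star = V * Smat L := by
    have hK : ∀ p q, (Smat L * V.map star) p q =
        conjS L (Sum.elim u (fun i => toEuclideanLin (Jmat L) (u i)) q) p := fun _ _ => rfl
    ext p q
    rw [hK]
    rcases q with j | j
    · rw [Sum.elim_inl, hA.K_frame h]
      simp [mul_apply, Smat, Rmat_apply, hVl, hu]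
    · rw [Sum.elim_inr, h.K_J, hA.K_frame h]
      simp [mul_apply, Smat, Rmat_apply, hVr, hu]
  have hD : M * V = V * Dmat L a := by
    ext p q
    rw [hVdef, mul_frameMatrix_apply, ← hVdef]
    rcases q with j | j
    · rw [Sum.elim_inl, hA.M_frame h]
      simp [mul_apply, Dmat, diagonal_apply, hVl, hu, mul_comm]
    · have h0 : dvec L a j ≠ 0 := by
        have := hA.one_le
        unfold dvec
        split_ifs
        · exact (zero_lt_one.trans_le (this _)).ne'
        · exact inv_ne_zero (zero_lt_one.trans_le (this _)).ne'
        · exact one_ne_zero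
      rw [Sum.elim_inr, h.M_J_eigen h0 (hA.M_frame h j)]
      simp [mul_apply, Dmat, diagonal_apply, hVr, hu, mul_comm]
  have hUMU : Vᴴ * M * Vᴴᴴ = Dmat L a := by
    rw [conjTranspose_conjTranspose, Matrix.mul_assoc, hD, ← Matrix.mul_assoc, hV, Matrix.one_mul]
  have hU := conjTranspose_mem_Gset_of_unitary hV hJ hS
  refine ⟨Vᴴ, a, hU, ?_, ?_, hanti, hA.one_le, hUMU, ?_⟩
  · rw [conjTranspose_conjTranspose, mul_eq_one_comm.1 hV]
  · rw [det_conjTranspose, det_eq_one_of_unitary hV hJ hS, star_one]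
  · rw [← hUMU, conjTranspose_conjTranspose]
    exact Gset_mul_mem (Gset_mul_mem hU hM) (mem_Gset_of_unitary hV hJ hS)
end
end
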